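/- arXiv:1507.05132 — 3 statements merged into one kernel-verified Lean document; each statement's English description precedes it below -/
import Mathlib

section
/- Kato's inequality for the fractional Laplacian: for f ∈ E, one has (-Δ)^{α/2}|f|(x) ≤ sgn(f(x))·(-Δ)^{α/2}f(x) for almost every x ∈ ℝⁿ. -/
open MeasureTheory Filter

/-- The fractional Laplacian `(-Δ)^{α/2}` with normalizing constant `C`,
defined as the principal-value singular integral. -/
noncomputable def fracLap (n : ℕ) (α C : ℝ)
    (u : EuclideanSpace ℝ (Fin n) → ℝ) (x : EuclideanSpace ℝ (Fin n)) : ℝ :=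
  C * limUnder (nhdsWithin (0 : ℝ) (Set.Ioi 0)) (fun ε : ℝ =>
    ∫ y in {y : EuclideanSpace ℝ (Fin n) | ε ≤ dist x y},
      (u x - u y) / dist x y ^ ((n : ℝ) + α))

/-- Membership in `E = C^{1,1}_loc(ℝⁿ) ∩ L_α`. -/
def MemE (n : ℕ) (α : ℝ) (u : EuclideanSpace ℝ (Fin n) → ℝ) : Prop :=
  Differentiable ℝ u ∧
  (∀ R : ℝ, ∃ K : NNReal, LipschitzOnWith K (fderiv ℝ u) (Metric.ball 0 R)) ∧
  Integrable (fun x : EuclideanSpace ℝ (Fin n) => |u x| / (1 + ‖x‖ ^ ((n : ℝ) + α)))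

section TruncatedIntegrals

variable {n : ℕ} {α : ℝ}

lemma integrableOn_compl_ball_sub_div_rpow_norm (hα : 0 < α)
    {u : EuclideanSpace ℝ (Fin n) → ℝ} (hu : Continuous u)
    (hint : Integrable (fun x => |u x| / (1 + ‖x‖ ^ ((n : ℝ) + α))))
    (x : EuclideanSpace ℝ (Fin n)) {ε : ℝ} (hε : 0 < ε) :
    IntegrableOn (fun h => (u x - u (x + h)) / ‖h‖ ^ ((n : ℝ) + α)) {h | ε ≤ ‖h‖} := by
  have hp : 0 < (n : ℝ) + α := by positivity
  set p : ℝ := (n : ℝ) + α with hp_def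
  have hS : MeasurableSet {h : EuclideanSpace ℝ (Fin n) | ε ≤ ‖h‖} :=
    measurableSet_le measurable_const measurable_norm
  have hjap : Integrable (fun h : EuclideanSpace ℝ (Fin n) => (1 + ‖h‖) ^ (-p)) := by
    apply integrable_one_add_norm
    simp [hp_def, hα]
  have hint' : Integrable (fun h => |u (x + h)| / (1 + ‖x + h‖ ^ p)) :=
    hint.comp_add_left x
  have hbound := (hjap.const_mul (|u x| * (1 / ε + 1) ^ p)).add
    (hint'.const_mul ((1 / ε) ^ p + (‖x‖ / ε + 1) ^ p))
  have hmeas : Measurable fun h => (u x - u (x + h)) / ‖h‖ ^ p := by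
    have := hu.measurable
    fun_prop
  refine hbound.integrableOn.mono' hmeas.aestronglyMeasurable ?_
  refine (ae_restrict_iff' hS).2 (Eventually.of_forall fun h hh => ?_)
  have hh' : ε ≤ ‖h‖ := hh
  have hpos : 0 < ‖h‖ := hε.trans_le hh'
  have hone : 1 ≤ 1 / ε * ‖h‖ := by
    rw [one_div, inv_mul_eq_div, one_le_div hε]; exact hh'
  have hle1 : (1 + ‖h‖) ^ p ≤ (1 / ε + 1) ^ p * ‖h‖ ^ p := by
    rw [← Real.mul_rpow (by positivity) hpos.le]
    apply Real.rpow_le_rpow (by positivity) _ hp.le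
    linarith
  have hle2 : 1 + ‖x + h‖ ^ p ≤ ((1 / ε) ^ p + (‖x‖ / ε + 1) ^ p) * ‖h‖ ^ p := by
    rw [add_mul, ← Real.mul_rpow (by positivity) hpos.le, ← Real.mul_rpow (by positivity) hpos.le]
    apply add_le_add
    · exact Real.one_le_rpow hone hp.le
    · apply Real.rpow_le_rpow (by positivity) _ hp.le
      have h1 : ‖x‖ * 1 ≤ ‖x‖ * (1 / ε * ‖h‖) := by gcongr
      have h2 := norm_add_le x h
      calc ‖x + h‖ ≤ ‖x‖ * (1 / ε * ‖h‖) + ‖h‖ := by linarith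
        _ = (‖x‖ / ε + 1) * ‖h‖ := by ring
  have hrp : 0 < ‖h‖ ^ p := Real.rpow_pos_of_pos hpos p
  have e1 : |u x| / ‖h‖ ^ p ≤ |u x| * (1 / ε + 1) ^ p * (1 + ‖h‖) ^ (-p) := by
    rw [Real.rpow_neg (by positivity), ← div_eq_mul_inv, div_le_div_iff₀ hrp (by positivity),
      mul_assoc]
    gcongr
  have e2 : |u (x + h)| / ‖h‖ ^ p ≤
      ((1 / ε) ^ p + (‖x‖ / ε + 1) ^ p) * (|u (x + h)| / (1 + ‖x + h‖ ^ p)) := by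
    rw [← mul_div_assoc, div_le_div_iff₀ hrp (by positivity)]
    calc |u (x + h)| * (1 + ‖x + h‖ ^ p)
        ≤ |u (x + h)| * (((1 / ε) ^ p + (‖x‖ / ε + 1) ^ p) * ‖h‖ ^ p) := by gcongr
      _ = _ := by ring
  calc ‖(u x - u (x + h)) / ‖h‖ ^ p‖ = |u x - u (x + h)| / ‖h‖ ^ p := by
        rw [norm_div, Real.norm_eq_abs, Real.norm_of_nonneg hrp.le]
    _ ≤ (|u x| + |u (x + h)|) / ‖h‖ ^ p := by gcongr; exact abs_sub _ _
    _ = |u x| / ‖h‖ ^ p + |u (x + h)| / ‖h‖ ^ p := add_div _ _ _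
    _ ≤ _ := add_le_add e1 e2

lemma setIntegral_dist_eq_setIntegral_norm (p : ℝ) (u : EuclideanSpace ℝ (Fin n) → ℝ)
    (x : EuclideanSpace ℝ (Fin n)) (ε : ℝ) :
    ∫ y in {y | ε ≤ dist x y}, (u x - u y) / dist x y ^ p =
      ∫ h in {h | ε ≤ ‖h‖}, (u x - u (x + h)) / ‖h‖ ^ p := by
  rw [← integral_indicator (measurableSet_le (by fun_prop) (by fun_prop)),
    ← integral_indicator (measurableSet_le (by fun_prop) (by fun_prop)),
    ← integral_add_left_eq_self _ x]
  congr 1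
  ext h
  simp [Set.indicator_apply]

lemma setIntegral_eq_zero_of_odd {g : EuclideanSpace ℝ (Fin n) → ℝ} (hg : ∀ h, g (-h) = -g h)
    (ε : ℝ) : ∫ h in {h | ε ≤ ‖h‖}, g h = 0 := by
  rw [← integral_indicator (measurableSet_le (by fun_prop) (by fun_prop))]
  set G := Set.indicator {h : EuclideanSpace ℝ (Fin n) | ε ≤ ‖h‖} g
  have hG : ∀ h, G (-h) = -G h := by
    intro h
    by_cases hh : ε ≤ ‖h‖ <;> simp [G, hh, hg]
  have h1 := integral_neg_eq_self G volume
  simp only [hG, integral_neg] at h1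
  linarith

/-- The principal value exists at a point where the function has a first-order expansion with
quadratic remainder. -/
lemma exists_tendsto_truncated_integral (hα : 0 < α) (hα2 : α < 2)
    {u : EuclideanSpace ℝ (Fin n) → ℝ} (hu : Continuous u)
    (hint : Integrable (fun x => |u x| / (1 + ‖x‖ ^ ((n : ℝ) + α))))
    {x : EuclideanSpace ℝ (Fin n)} (A : EuclideanSpace ℝ (Fin n) →L[ℝ] ℝ) {K r : ℝ} (hr : 0 < r)
    (hA : ∀ h, ‖h‖ < r → |u (x + h) - u x - A h| ≤ K * ‖h‖ ^ 2) :
    ∃ L, Tendsto (fun ε : ℝ => ∫ y in {y | ε ≤ dist x y}, (u x - u y) / dist x y ^ ((n : ℝ) + α))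
      (nhdsWithin 0 (Set.Ioi 0)) (nhds L) := by
  set p : ℝ := (n : ℝ) + α with hp_def
  simp only [setIntegral_dist_eq_setIntegral_norm]
  set G : EuclideanSpace ℝ (Fin n) → ℝ := fun h => (u x - u (x + h)) / ‖h‖ ^ p with hG_def
  set L : EuclideanSpace ℝ (Fin n) → ℝ := (Metric.ball 0 r).indicator fun h => A h / ‖h‖ ^ p
    with hL_def
  have hS : ∀ ε : ℝ, MeasurableSet {h : EuclideanSpace ℝ (Fin n) | ε ≤ ‖h‖} := fun ε =>
    measurableSet_le measurable_const measurable_norm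
  have hGint : ∀ ε : ℝ, 0 < ε → IntegrableOn G {h | ε ≤ ‖h‖} := fun ε hε =>
    integrableOn_compl_ball_sub_div_rpow_norm hα hu hint x hε
  have hLodd : ∀ h, L (-h) = -L h := by
    intro h
    by_cases hh : ‖h‖ < r <;> simp [L, hh, neg_div]
  have hLmeas : Measurable L :=
    Measurable.indicator (by fun_prop) measurableSet_ball
  have hGmeas : Measurable G := by
    have := hu.measurable
    fun_prop
  have hH0 : (G + L) 0 = 0 := by simp [G, L]
  have hHint : Integrable (G + L) := by
    rcases Nat.eq_zero_or_pos n with hn | hn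
    · subst hn
      have : G + L = 0 := by
        ext h
        rw [Subsingleton.elim h 0, hH0, Pi.zero_apply]
      rw [this]
      exact integrable_zero _ _ _
    · rw [← integrableOn_univ, ← Set.union_compl_self (Metric.ball 0 r)]
      refine IntegrableOn.union ?_ ?_
      · refine integrableOn_ball_of_norm_le_rpow (C := |K|) (α := p - 2) ?_ ?_ ?_
          (hGmeas.add hLmeas).aestronglyMeasurable
        · rw [finrank_euclideanSpace, Fintype.card_fin]
          exact hn
        · simp only [finrank_euclideanSpace, Fintype.card_fin]; linarith
        · refine (ae_restrict_iff' measurableSet_ball).2 (Eventually.of_forall fun h hh => ?_)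
          rcases eq_or_ne h 0 with rfl | h0
          · rw [hH0, norm_zero]
            positivity
          · have hpos : 0 < ‖h‖ := norm_pos_iff.2 h0
            have hrp : 0 < ‖h‖ ^ p := Real.rpow_pos_of_pos hpos p
            have hval : (G + L) h = -(u (x + h) - u x - A h) / ‖h‖ ^ p := by
              simp only [Pi.add_apply, hG_def, hL_def, Set.indicator_of_mem hh]
              ring
            rw [hval, norm_div, norm_neg, Real.norm_eq_abs, Real.norm_of_nonneg hrp.le,
              div_le_iff₀ hrp, mul_assoc, ← Real.rpow_add hpos]
            have : -(p - 2) + p = (2 : ℕ) := by push_cast; ring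
            rw [this, Real.rpow_natCast]
            exact (hA h (by simpa using hh)).trans
              (mul_le_mul_of_nonneg_right (le_abs_self K) (sq_nonneg _))
      · have hc : (Metric.ball (0 : EuclideanSpace ℝ (Fin n)) r)ᶜ = {h | r ≤ ‖h‖} := by
          ext h; simp
        rw [hc]
        refine (hGint r hr).congr_fun (fun h hh => ?_) (hS r)
        have : h ∉ Metric.ball (0 : EuclideanSpace ℝ (Fin n)) r := by simpa using hh
        simp [L, Set.indicator_of_notMem this]
  refine ⟨∫ h, (G + L) h, ?_⟩
  have hlim : Tendsto (fun ε : ℝ => ∫ h, {h | ε ≤ ‖h‖}.indicator (G + L) h)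
      (nhdsWithin 0 (Set.Ioi 0)) (nhds (∫ h, (G + L) h)) := by
    refine tendsto_integral_filter_of_dominated_convergence (fun h => ‖(G + L) h‖) ?_ ?_
      hHint.norm ?_
    · exact Eventually.of_forall fun ε =>
        ((hGmeas.add hLmeas).indicator (hS ε)).aestronglyMeasurable
    · exact Eventually.of_forall fun ε => Eventually.of_forall fun h =>
        norm_indicator_le_norm_self _ _
    · refine Eventually.of_forall fun h => ?_
      rcases eq_or_ne h 0 with rfl | h0
      · simp only [Set.indicator_apply, hH0, ite_self]
        exact tendsto_const_nhds
      · refine tendsto_const_nhds.congr' ?_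
        have hpos : (0 : ℝ) < ‖h‖ := norm_pos_iff.2 h0
        filter_upwards [nhdsWithin_le_nhds (Iio_mem_nhds hpos)] with ε hε
        have hmem : h ∈ {h : EuclideanSpace ℝ (Fin n) | ε ≤ ‖h‖} :=
          (Set.mem_Iio.1 hε).le
        exact (Set.indicator_of_mem hmem _).symm
  refine hlim.congr' ?_
  filter_upwards [self_mem_nhdsWithin] with ε hε
  have hLint : IntegrableOn L {h | ε ≤ ‖h‖} := by
    have := hHint.integrableOn.sub (hGint ε hε)
    simpa using this
  rw [integral_indicator (hS ε)]
  have := integral_add (hGint ε hε) hLint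
  rw [setIntegral_eq_zero_of_odd hLodd, add_zero] at this
  exact this

end TruncatedIntegrals

/-- At almost every zero of a differentiable function, its derivative vanishes. -/
lemma ae_fderiv_eq_zero_of_eq_zero {E : Type*} [NormedAddCommGroup E] [NormedSpace ℝ E]
    [FiniteDimensional ℝ E] [MeasurableSpace E] [BorelSpace E] (μ : Measure E)
    [μ.IsAddHaarMeasure] {f : E → ℝ} (hf : Differentiable ℝ f) :
    ∀ᵐ x ∂μ, f x = 0 → fderiv ℝ f x = 0 := by
  rcases subsingleton_or_nontrivial E with hE | hE
  · refine Eventually.of_forall fun x _ => ?_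
    ext v
    simp [Subsingleton.elim v 0]
  obtain ⟨v, hv⟩ := exists_ne (0 : E)
  have hs : MeasurableSet {x | f x = 0} :=
    (isClosed_singleton.preimage hf.continuous).measurableSet
  have happ : ApproximatesLinearOn (fun x => f x • v) (0 : E →L[ℝ] E) {x | f x = 0} 0 := by
    intro x hx y hy
    simp [show f x = 0 from hx, show f y = 0 from hy]
  have := happ.norm_fderiv_sub_le μ hs (fun x => (fderiv ℝ f x).smulRight v) fun x _ =>
    ((hf x).hasFDerivAt.smul_const v).hasFDerivWithinAt
  filter_upwards [(ae_restrict_iff' hs).1 this] with x hx h0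
  have h1 := hx h0
  simp only [sub_zero, nonpos_iff_eq_zero, nnnorm_eq_zero] at h1
  ext w
  have h2 := congrArg (fun T : E →L[ℝ] E => T w) h1
  simpa [hv] using h2

lemma abs_sub_sub_fderiv_le_of_lipschitzOnWith {E : Type*} [NormedAddCommGroup E]
    [NormedSpace ℝ E] {f : E → ℝ} (hf : Differentiable ℝ f) {K : NNReal} {x : E} {r : ℝ}
    (hr : 0 < r)
    (hK : LipschitzOnWith K (fderiv ℝ f) (Metric.ball x r)) {h : E} (hh : ‖h‖ < r) :
    |f (x + h) - f x - fderiv ℝ f x h| ≤ K * ‖h‖ ^ 2 := by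
  have key := (convex_segment (𝕜 := ℝ) x (x + h)).norm_image_sub_le_of_norm_fderiv_le'
    (f := f) (φ := fderiv ℝ f x) (C := K * ‖h‖) (fun y _ => hf y) (fun y hy => ?_)
    (left_mem_segment ℝ x (x + h)) (right_mem_segment ℝ x (x + h))
  · rw [add_sub_cancel_left, Real.norm_eq_abs] at key
    linarith
  · have hyx : ‖y - x‖ ≤ ‖h‖ := by
      rw [segment_eq_image'] at hy
      obtain ⟨t, ht, rfl⟩ := hy
      simp only [add_sub_cancel_left, norm_smul, Real.norm_of_nonneg ht.1]
      exact mul_le_of_le_one_left (norm_nonneg _) ht.2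
    refine (hK.norm_sub_le (by simpa [dist_eq_norm] using hyx.trans_lt hh)
      (Metric.mem_ball_self hr)).trans ?_
    gcongr

/-- Kato's inequality for the fractional Laplacian. -/
theorem stmt1 (n : ℕ) (α C : ℝ) (hα : 0 < α) (hα2 : α < 2) (hC : 0 < C)
    (f : EuclideanSpace ℝ (Fin n) → ℝ) (hf : MemE n α f) :
    ∀ᵐ x : EuclideanSpace ℝ (Fin n),
      fracLap n α C (fun x => |f x|) x ≤ Real.sign (f x) * fracLap n α C f x := by
  obtain ⟨hdiff, hLip, hint⟩ := hf
  have hcont : Continuous f := hdiff.continuous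
  have hcont' : Continuous fun x => |f x| := hcont.abs
  have hint' : Integrable (fun x : EuclideanSpace ℝ (Fin n) =>
      |(fun x => |f x|) x| / (1 + ‖x‖ ^ ((n : ℝ) + α))) := by simpa using hint
  filter_upwards [ae_fderiv_eq_zero_of_eq_zero volume hdiff] with x hx
  obtain ⟨K, hK⟩ := hLip (‖x‖ + 1)
  have hK1 : LipschitzOnWith K (fderiv ℝ f) (Metric.ball x 1) := by
    refine hK.mono (Metric.ball_subset_ball' ?_)
    rw [dist_zero_right, add_comm]
  have hquad : ∀ h, ‖h‖ < 1 → |f (x + h) - f x - fderiv ℝ f x h| ≤ K * ‖h‖ ^ 2 := fun h hh =>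
    abs_sub_sub_fderiv_le_of_lipschitzOnWith hdiff one_pos hK1 hh
  obtain ⟨L, hL⟩ := exists_tendsto_truncated_integral hα hα2 hcont hint _ one_pos hquad
  obtain ⟨L', hL'⟩ : ∃ L', Tendsto (fun ε : ℝ => ∫ y in {y | ε ≤ dist x y},
      (|f x| - |f y|) / dist x y ^ ((n : ℝ) + α)) (nhdsWithin 0 (Set.Ioi 0)) (nhds L') := by
    rcases eq_or_ne (f x) 0 with h0 | h0
    · refine exists_tendsto_truncated_integral hα hα2 hcont' hint' 0 one_pos (K := K) ?_
      intro h hh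
      simpa [hx h0, h0] using hquad h hh
    · have hev : ∀ᶠ y in nhds x, |f y| = Real.sign (f x) * f y := by
        rcases lt_or_gt_of_ne h0 with hneg | hpos
        · filter_upwards [hcont.continuousAt.eventually_lt_const hneg] with y hy
          rw [Real.sign_of_neg hneg, abs_of_neg hy, neg_one_mul]
        · filter_upwards [hcont.continuousAt.eventually_const_lt hpos] with y hy
          rw [Real.sign_of_pos hpos, abs_of_pos hy, one_mul]
      obtain ⟨δ, hδ, hball⟩ := Metric.eventually_nhds_iff.1 hev
      refine exists_tendsto_truncated_integral hα hα2 hcont' hint'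
        (Real.sign (f x) • fderiv ℝ f x) (lt_min hδ one_pos) (K := K) ?_
      intro h hh
      have h1 := hball (y := x + h) (by simpa using hh.trans_le (min_le_left _ _))
      have h2 := hball (y := x) (by simpa using hδ)
      have hs : |Real.sign (f x)| = 1 := by
        rcases Real.sign_apply_eq_of_ne_zero _ h0 with hs | hs <;> simp [hs]
      simp only [h1, h2, smul_apply, smul_eq_mul]
      rw [← mul_sub, ← mul_sub, abs_mul, hs, one_mul]
      exact hquad h (hh.trans_le (min_le_right _ _))
  have hle : L' ≤ Real.sign (f x) * L := by
    refine le_of_tendsto_of_tendsto hL' (hL.const_mul _) ?_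
    filter_upwards [self_mem_nhdsWithin] with ε hε
    rw [setIntegral_dist_eq_setIntegral_norm, ← integral_const_mul,
      setIntegral_dist_eq_setIntegral_norm _ (fun x => |f x|)]
    refine setIntegral_mono
      (integrableOn_compl_ball_sub_div_rpow_norm hα hcont' hint' x hε)
      ((integrableOn_compl_ball_sub_div_rpow_norm hα hcont hint x hε).const_mul _) fun h => ?_
    simp only [← mul_div_assoc]
    gcongr
    rcases lt_trichotomy (f x) 0 with h0 | h0 | h0
    · rw [Real.sign_of_neg h0, abs_of_neg h0]
      linarith [neg_le_abs (f (x + h))]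
    · simp [h0]
    · rw [Real.sign_of_pos h0, abs_of_pos h0]
      linarith [le_abs_self (f (x + h))]
  simp only [fracLap]
  rw [hL.limUnder_eq, hL'.limUnder_eq, mul_left_comm]
  exact mul_le_mul_of_nonneg_left hle hC.le
end

section
/- If u ∈ E solves (-Δ)^{α/2}u = u(1 − |u|²) in ℝⁿ, then the function Q(x) = u(x)² − 1 satisfies the differential inequality (-Δ)^{α/2}Q(x) ≤ −2Q(x)² − 2Q(x) pointwise on ℝⁿ. -/
open MeasureTheory Filter

open scoped Topology

theorem integrable_one_div_one_add_norm_rpow {n : ℕ} {p : ℝ} (hp : (n : ℝ) < p) :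
    Integrable (fun y : EuclideanSpace ℝ (Fin n) => 1 / (1 + ‖y‖ ^ p)) := by
  have hp0 : 0 ≤ p := (Nat.cast_nonneg n).trans hp.le
  have h := (integrable_one_add_norm (E := EuclideanSpace ℝ (Fin n)) (μ := volume) (r := p)
    (by simpa using hp)).const_mul (2 ^ p)
  refine h.mono' (Measurable.aestronglyMeasurable (by fun_prop)) (ae_of_all _ fun y => ?_)
  have h0 := norm_nonneg y
  have h1 : 0 ≤ ‖y‖ ^ p := by positivity
  rw [Real.norm_of_nonneg (by positivity), Real.rpow_neg (by positivity), ← div_eq_mul_inv,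
    div_le_div_iff₀ (by positivity) (by positivity), one_mul]
  rcases le_total ‖y‖ 1 with hy | hy
  · calc (1 + ‖y‖) ^ p ≤ 2 ^ p := Real.rpow_le_rpow (by positivity) (by linarith) hp0
      _ ≤ 2 ^ p * (1 + ‖y‖ ^ p) := le_mul_of_one_le_right (by positivity) (by linarith)
  · calc (1 + ‖y‖) ^ p ≤ (2 * ‖y‖) ^ p := Real.rpow_le_rpow (by positivity) (by linarith) hp0
      _ = 2 ^ p * ‖y‖ ^ p := Real.mul_rpow (by norm_num) h0
      _ ≤ 2 ^ p * (1 + ‖y‖ ^ p) := by gcongr; linarith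

theorem integrableOn_norm_rpow_ball {n : ℕ} {s : ℝ} (hs : -(n : ℝ) < s) :
    IntegrableOn (fun z : EuclideanSpace ℝ (Fin n) => ‖z‖ ^ s) (Metric.ball 0 1) := by
  rcases Nat.eq_zero_or_pos n with rfl | hn
  · have : (fun z : EuclideanSpace ℝ (Fin 0) => ‖z‖ ^ s) = fun _ => (0 : ℝ) ^ s := by
      funext z
      rw [Subsingleton.elim z 0, norm_zero]
    rw [this]
    exact integrableOn_const measure_ball_lt_top.ne
  · have : Nonempty (Fin n) := ⟨⟨0, hn⟩⟩
    have key := (integrable_fun_norm_addHaar (E := EuclideanSpace ℝ (Fin n)) (F := ℝ)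
      volume (f := (Set.Iio (1 : ℝ)).indicator fun t => t ^ s)).2 ?_
    · rw [← integrable_indicator_iff measurableSet_ball]
      refine key.congr (ae_of_all _ fun z => ?_)
      simp [Set.indicator]
    · have h1 := (intervalIntegral.integrableOn_Ioo_rpow_iff (s := (n : ℝ) - 1 + s)
        (t := 1) one_pos).2 (by linarith)
      rw [← integrable_indicator_iff measurableSet_Ioo] at h1
      rw [← integrable_indicator_iff measurableSet_Ioi]
      refine h1.congr (ae_of_all _ fun t => ?_)
      by_cases h0 : 0 < t <;> by_cases ht : t < 1 <;> simp [Set.indicator, h0, ht]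
      rw [Real.rpow_add h0, ← Real.rpow_natCast, Nat.cast_sub hn, Nat.cast_one]

theorem MemE.continuous {n : ℕ} {α : ℝ} {f : EuclideanSpace ℝ (Fin n) → ℝ} (hf : MemE n α f) :
    Continuous f :=
  hf.1.continuous

theorem MemE.integrableOn_truncated {n : ℕ} {α : ℝ} (hα : 0 < α)
    {f : EuclideanSpace ℝ (Fin n) → ℝ} (hf : MemE n α f) (x : EuclideanSpace ℝ (Fin n))
    {ε : ℝ} (hε : 0 < ε) :
    IntegrableOn (fun y => (f x - f y) / dist x y ^ ((n : ℝ) + α)) {y | ε ≤ dist x y} := by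
  have hp : (n : ℝ) < n + α := by linarith
  have hp0 : 0 ≤ (n : ℝ) + α := by positivity
  have hfm := hf.continuous.measurable
  set p := (n : ℝ) + α
  set A : ℝ := (1 / ε) ^ p + (‖x‖ / ε + 1) ^ p
  have hA : 0 ≤ A := by positivity
  have hint := (((integrable_one_div_one_add_norm_rpow hp).const_mul |f x|).add
    hf.2.2).const_mul A
  refine hint.integrableOn.mono' (Measurable.aestronglyMeasurable (by fun_prop)) ?_
  refine (ae_restrict_iff' (measurableSet_le measurable_const (by fun_prop))).2
    (ae_of_all _ fun y (hy : ε ≤ dist x y) => ?_)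
  have hd : 0 < dist x y := hε.trans_le hy
  have hy1 : 1 ≤ dist x y / ε := (one_le_div hε).2 hy
  have hnorm : ‖y‖ ≤ (‖x‖ / ε + 1) * dist x y := by
    have h1 : ‖y‖ ≤ ‖x‖ + dist x y := by
      have := norm_sub_norm_le y x
      rw [dist_comm, dist_eq_norm]
      linarith
    have h2 : ‖x‖ ≤ ‖x‖ * (dist x y / ε) := le_mul_of_one_le_right (norm_nonneg x) hy1
    calc ‖y‖ ≤ ‖x‖ * (dist x y / ε) + dist x y := by linarith
      _ = _ := by ring
  have hw : 1 + ‖y‖ ^ p ≤ A * dist x y ^ p := by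
    rw [add_mul, ← Real.mul_rpow (by positivity) hd.le, ← Real.mul_rpow (by positivity) hd.le]
    refine add_le_add (Real.one_le_rpow ?_ hp0) (Real.rpow_le_rpow (norm_nonneg y) hnorm hp0)
    rwa [one_div_mul_eq_div]
  have hw0 : 0 < 1 + ‖y‖ ^ p := by positivity
  rw [norm_div, Real.norm_of_nonneg (Real.rpow_nonneg hd.le p), Real.norm_eq_abs]
  calc |f x - f y| / dist x y ^ p ≤ (|f x| + |f y|) / dist x y ^ p := by
        gcongr; exact abs_sub _ _
    _ ≤ A * ((|f x| + |f y|) / (1 + ‖y‖ ^ p)) := by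
        rw [← mul_div_assoc, div_le_div_iff₀ (by positivity) hw0]
        have : 0 ≤ |f x| + |f y| := by positivity
        nlinarith
    _ = _ := by simp only [Pi.add_apply]; ring

theorem MemE.exists_secondDifference_bound {n : ℕ} {α : ℝ}
    {f : EuclideanSpace ℝ (Fin n) → ℝ} (hf : MemE n α f) (x : EuclideanSpace ℝ (Fin n)) :
    ∃ K : ℝ, 0 ≤ K ∧ ∀ z, ‖z‖ < 1 → |(f x - f (x + z)) + (f x - f (x + -z))| ≤ K * ‖z‖ ^ 2 := by
  obtain ⟨K, hK⟩ := hf.2.1 (‖x‖ + 1)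
  have key : ∀ z : EuclideanSpace ℝ (Fin n), ‖z‖ < 1 →
      |f (x + z) - f x - fderiv ℝ f x z| ≤ K * ‖z‖ * ‖z‖ := by
    intro z hz
    have h := (convex_closedBall x ‖z‖).norm_image_sub_le_of_norm_fderiv_le' (𝕜 := ℝ) (f := f)
      (φ := fderiv ℝ f x) (C := K * ‖z‖) (x := x) (y := x + z) (fun y _ => hf.1 y)
      (fun y hy => ?_) (by simp) (by simp)
    · simpa using h
    · rw [Metric.mem_closedBall] at hy
      have hyb : y ∈ Metric.ball (0 : EuclideanSpace ℝ (Fin n)) (‖x‖ + 1) := by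
        have := norm_sub_norm_le y x
        rw [dist_eq_norm] at hy
        rw [mem_ball_zero_iff]
        linarith
      have hxb : x ∈ Metric.ball (0 : EuclideanSpace ℝ (Fin n)) (‖x‖ + 1) := by simp
      rw [← dist_eq_norm]
      exact (hK.dist_le_mul y hyb x hxb).trans (by gcongr)
  refine ⟨2 * K, by positivity, fun z hz => ?_⟩
  have h1 := abs_le.1 (key z hz)
  have h2 := abs_le.1 (key (-z) (by simpa using hz))
  simp only [map_neg, norm_neg] at h2
  rw [abs_le]
  constructor <;> nlinarith [h1.1, h1.2, h2.1, h2.2]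

theorem MemE.exists_tendsto_truncated {n : ℕ} {α : ℝ} (hα : 0 < α) (hα2 : α < 2)
    {f : EuclideanSpace ℝ (Fin n) → ℝ} (hf : MemE n α f) (x : EuclideanSpace ℝ (Fin n)) :
    ∃ L : ℝ, Tendsto (fun ε : ℝ => ∫ y in {y : EuclideanSpace ℝ (Fin n) | ε ≤ dist x y},
      (f x - f y) / dist x y ^ ((n : ℝ) + α)) (𝓝[>] 0) (𝓝 L) := by
  have hfm := hf.continuous.measurable
  have hint := fun (ε : ℝ) (hε : 0 < ε) => hf.integrableOn_truncated hα x hε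
  set p := (n : ℝ) + α with hpdef
  have hms : ∀ ε : ℝ, MeasurableSet {y : EuclideanSpace ℝ (Fin n) | ε ≤ dist x y} := fun ε =>
    measurableSet_le measurable_const (by fun_prop)
  have hms' : ∀ ε : ℝ, MeasurableSet {z : EuclideanSpace ℝ (Fin n) | ε ≤ ‖z‖} := fun ε =>
    measurableSet_le measurable_const (by fun_prop)
  let F : ℝ → EuclideanSpace ℝ (Fin n) → ℝ := fun ε =>
    {z | ε ≤ ‖z‖}.indicator fun z => (f x - f (x + z)) / ‖z‖ ^ p
  let G : EuclideanSpace ℝ (Fin n) → ℝ := fun z =>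
    ((f x - f (x + z)) + (f x - f (x + -z))) / ‖z‖ ^ p / 2
  have hFshift : ∀ ε z, F ε z = {y : EuclideanSpace ℝ (Fin n) | ε ≤ dist x y}.indicator
      (fun y => (f x - f y) / dist x y ^ p) (x + z) := fun ε z => by
    simp [F, Set.indicator]
  have hFint : ∀ ε, 0 < ε → Integrable (F ε) := fun ε hε => by
    rw [funext (hFshift ε)]
    exact ((integrable_indicator_iff (hms ε)).2 (hint ε hε)).comp_add_left x
  have hFG : ∀ ε z, {z | ε ≤ ‖z‖}.indicator G z = (F ε z + F ε (-z)) / 2 := fun ε z => by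
    by_cases h : ε ≤ ‖z‖
    · simp only [F, G, Set.indicator, Set.mem_ofPred_eq, h, norm_neg, if_true]; ring
    · simp [F, G, Set.indicator, h]
  have hFGint : ∀ ε, 0 < ε → Integrable ({z | ε ≤ ‖z‖}.indicator G) := fun ε hε => by
    rw [funext (hFG ε)]
    exact ((hFint ε hε).add (hFint ε hε).comp_neg).div_const 2
  have heq : ∀ ε, 0 < ε → ∫ y in {y : EuclideanSpace ℝ (Fin n) | ε ≤ dist x y},
      (f x - f y) / dist x y ^ p = ∫ z, {z | ε ≤ ‖z‖}.indicator G z := fun ε hε => by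
    rw [funext (hFG ε), integral_div, integral_add (hFint ε hε) (hFint ε hε).comp_neg,
      integral_neg_eq_self (F ε) volume, add_self_div_two, funext (hFshift ε),
      integral_add_left_eq_self, integral_indicator (hms ε)]
  have hGm : Measurable G := by fun_prop
  have hG : Integrable G := by
    rw [← integrableOn_univ, ← Set.compl_union_self {z : EuclideanSpace ℝ (Fin n) | 1 ≤ ‖z‖}]
    refine IntegrableOn.union ?_ ((integrable_indicator_iff (hms' 1)).1 (hFGint 1 one_pos))
    obtain ⟨K, hK0, hK⟩ := hf.exists_secondDifference_bound x
    have hset : {z : EuclideanSpace ℝ (Fin n) | 1 ≤ ‖z‖}ᶜ = Metric.ball 0 1 := by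
      ext z; simp
    rw [hset]
    refine ((integrableOn_norm_rpow_ball (n := n) (s := 2 - p)
      (by rw [hpdef]; linarith)).const_mul (K / 2)).mono' hGm.aestronglyMeasurable ?_
    refine (ae_restrict_iff' measurableSet_ball).2 (ae_of_all _ fun z hz => ?_)
    rw [mem_ball_zero_iff] at hz
    rcases eq_or_ne z 0 with rfl | hz0
    · simp only [G, add_zero, neg_zero, sub_self, zero_div, norm_zero]
      positivity
    · have hzp : 0 < ‖z‖ := norm_pos_iff.2 hz0
      rw [norm_div, norm_div, Real.norm_of_nonneg (Real.rpow_nonneg hzp.le p), Real.norm_eq_abs,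
        Real.norm_eq_abs, abs_two, Real.rpow_sub hzp, Real.rpow_two]
      calc _ ≤ K * ‖z‖ ^ 2 / ‖z‖ ^ p / 2 := by gcongr; exact hK z hz
        _ = _ := by ring
  refine ⟨∫ z, G z, ?_⟩
  refine Tendsto.congr' (f₁ := fun ε : ℝ => ∫ z, {z | ε ≤ ‖z‖}.indicator G z) ?_ ?_
  · filter_upwards [self_mem_nhdsWithin] with ε hε using (heq ε hε).symm
  · refine tendsto_integral_filter_of_dominated_convergence (fun z => ‖G z‖)
      (Eventually.of_forall fun ε => (hGm.indicator (hms' ε)).aestronglyMeasurable)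
      (Eventually.of_forall fun ε => ae_of_all _ fun z => norm_indicator_le_norm_self G z)
      hG.norm (ae_of_all _ fun z => ?_)
    rcases eq_or_ne z 0 with rfl | hz0
    · have : ∀ ε : ℝ, {z : EuclideanSpace ℝ (Fin n) | ε ≤ ‖z‖}.indicator G 0 = G 0 := fun ε => by
        simp [G, Set.indicator]
      simpa only [this] using tendsto_const_nhds
    · refine tendsto_const_nhds.congr' ?_
      filter_upwards [mem_nhdsWithin_of_mem_nhds (Iio_mem_nhds (norm_pos_iff.2 hz0))] with ε hε
      have hmem : z ∈ {z : EuclideanSpace ℝ (Fin n) | ε ≤ ‖z‖} := by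
        simpa using (Set.mem_Iio.1 hε).le
      exact (Set.indicator_of_mem hmem G).symm

theorem stmt5 (n : ℕ) (α C : ℝ) (hα : 0 < α) (hα2 : α < 2) (hC : 0 < C)
    (u : EuclideanSpace ℝ (Fin n) → ℝ) (hu : MemE n α u)
    (hQ : MemE n α (fun x => u x ^ 2 - 1))
    (heq : ∀ x, fracLap n α C u x = u x * (1 - |u x| ^ 2)) :
    ∀ x, fracLap n α C (fun x => u x ^ 2 - 1) x
      ≤ -2 * (u x ^ 2 - 1) ^ 2 - 2 * (u x ^ 2 - 1) := by
  intro x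
  obtain ⟨L, hL⟩ := hu.exists_tendsto_truncated hα hα2 x
  obtain ⟨M, hM⟩ := hQ.exists_tendsto_truncated hα hα2 x
  have hML : M ≤ 2 * u x * L := by
    refine le_of_tendsto_of_tendsto hM (hL.const_mul (2 * u x)) ?_
    filter_upwards [self_mem_nhdsWithin] with ε hε
    rw [← integral_const_mul]
    refine integral_mono (hQ.integrableOn_truncated hα x hε)
      ((hu.integrableOn_truncated hα x hε).const_mul (2 * u x)) fun y => ?_
    rw [← mul_div_assoc]
    gcongr
    nlinarith [sq_nonneg (u x - u y)]
  have hux := heq x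
  simp only [fracLap, hL.limUnder_eq, sq_abs] at hux
  simp only [fracLap, hM.limUnder_eq]
  calc C * M ≤ C * (2 * u x * L) := by gcongr
    _ = 2 * u x * (C * L) := by ring
    _ = _ := by rw [hux]; ring
end

section
/- Vector-valued Brezis theorem for the fractional Ginzburg-Landau system: if u : ℝⁿ → ℝ^N has each component in E, solves (-Δ)^{α/2}u = u(1 − |u|²) componentwise in ℝⁿ, and satisfies ∫_{ℝⁿ}(1 − |u|²)² dx < ∞, then |u(x)| ≤ 1 for all x ∈ ℝⁿ. -/
open MeasureTheory Filter

open Metric Topology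

section TruncatedKernel

variable {E : Type*} [NormedAddCommGroup E]

/-- The kernel `‖z‖ ^ (-p)` cut off to the region `ε ≤ ‖z‖`. -/
noncomputable def truncKernel (p ε : ℝ) (z : E) : ℝ :=
  {z : E | ε ≤ ‖z‖}.indicator (fun z => (‖z‖ ^ p)⁻¹) z

lemma truncKernel_nonneg (p ε : ℝ) (z : E) : 0 ≤ truncKernel p ε z :=
  Set.indicator_nonneg (fun _ _ => by positivity) z

lemma truncKernel_neg (p ε : ℝ) (z : E) : truncKernel p ε (-z) = truncKernel p ε z := by
  simp [truncKernel, Set.indicator_apply]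

lemma truncKernel_le {p ε : ℝ} (hp : 0 ≤ p) (hε : 0 < ε) (z : E) :
    truncKernel p ε z ≤ (ε ^ p)⁻¹ := by
  refine Set.indicator_apply_le' (fun (hz : ε ≤ ‖z‖) => ?_) (fun _ => by positivity)
  have := Real.rpow_le_rpow hε.le hz hp
  gcongr

lemma measurable_truncKernel [MeasurableSpace E] [BorelSpace E] (p ε : ℝ) :
    Measurable (truncKernel p ε : E → ℝ) := by
  refine Measurable.indicator (by fun_prop) ?_
  exact measurableSet_le measurable_const measurable_norm

lemma tendsto_setIntegral_compl_ball_zero [MeasurableSpace E] [BorelSpace E]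
    {μ : Measure E} {f : E → ℝ} (hf : Integrable f μ) :
    Tendsto (fun r : ℝ => ∫ x in (ball (0 : E) r)ᶜ, f x ∂μ) atTop (𝓝 0) := by
  have h := tendsto_setIntegral_of_antitone (f := f) (μ := μ) (s := fun r : ℝ => (ball (0 : E) r)ᶜ)
    (fun r => measurableSet_ball.compl)
    (fun r s hrs => Set.compl_subset_compl.mpr (ball_subset_ball hrs)) ⟨0, hf.integrableOn⟩
  have hempty : ⋂ r : ℝ, (ball (0 : E) r)ᶜ = ∅ := by
    rw [← Set.compl_iUnion, Set.compl_empty_iff]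
    exact Set.eq_univ_of_forall fun x => Set.mem_iUnion.mpr ⟨‖x‖ + 1, by simp⟩
  simpa [hempty] using h

variable [NormedSpace ℝ E]

lemma abs_sub_add_fderiv_le {f : E → ℝ} (hf : Differentiable ℝ f) {K : NNReal} {s : Set E}
    (hK : LipschitzOnWith K (fderiv ℝ f) s) {y z : E} (hs : closedBall y ‖z‖ ⊆ s) :
    |f y - f (y + z) + fderiv ℝ f y z| ≤ K * ‖z‖ ^ 2 := by
  have hy : y ∈ closedBall y ‖z‖ := mem_closedBall_self (norm_nonneg z)
  have hyz : y + z ∈ closedBall y ‖z‖ := by simp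
  have h := Convex.norm_image_sub_le_of_norm_fderiv_le' (𝕜 := ℝ) (f := f) (φ := fderiv ℝ f y)
    (C := K * ‖z‖) (fun x _ => hf x) (fun x hx => ?_) (convex_closedBall y ‖z‖) hy hyz
  · rw [add_sub_cancel_left, Real.norm_eq_abs, mul_assoc, ← sq] at h
    rw [← abs_neg]
    convert h using 2
    ring
  · refine (hK.norm_sub_le (hs hx) (hs hy)).trans ?_
    gcongr
    simpa [dist_eq_norm] using hx

variable [FiniteDimensional ℝ E] [MeasurableSpace E] [BorelSpace E]

lemma integrable_truncKernel {μ : Measure E} [Measure.IsAddHaarMeasure μ] {p ε : ℝ}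
    (hp : Module.finrank ℝ E < p) (hε : 0 < ε) :
    Integrable (truncKernel p ε : E → ℝ) μ := by
  have hp0 : 0 ≤ p := (Nat.cast_nonneg _).trans hp.le
  refine ((integrable_one_add_norm (μ := μ) hp).const_mul ((ε⁻¹ + 1) ^ p)).mono'
    (measurable_truncKernel p ε).aestronglyMeasurable (.of_forall fun z => ?_)
  rw [Real.norm_of_nonneg (truncKernel_nonneg p ε z)]
  refine Set.indicator_apply_le' (fun (hz : ε ≤ ‖z‖) => ?_) (fun _ => by positivity)
  have hz0 : 0 < ‖z‖ := hε.trans_le hz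
  have h1 : 1 + ‖z‖ ≤ (ε⁻¹ + 1) * ‖z‖ := by
    have : 1 ≤ ε⁻¹ * ‖z‖ := by rwa [← div_eq_inv_mul, one_le_div hε]
    linarith
  have h2 := Real.rpow_le_rpow (by positivity) h1 hp0
  rw [Real.mul_rpow (by positivity) hz0.le] at h2
  rw [Real.rpow_neg (by positivity), inv_le_iff_one_le_mul₀ (by positivity), mul_right_comm,
    ← div_eq_mul_inv, one_le_div (by positivity)]
  exact h2

lemma integrable_truncKernel_mul_comp_add {μ : Measure E} [Measure.IsAddHaarMeasure μ] {p ε : ℝ}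
    (hp : Module.finrank ℝ E < p) (hε : 0 < ε) {f G : E → ℝ} (hf : Continuous f)
    (hG : Integrable G μ) (c : ℝ) (hfG : ∀ x, |f x| ≤ c + G x) (y : E) :
    Integrable (fun z => truncKernel p ε z * f (y + z)) μ := by
  have hp0 : 0 ≤ p := (Nat.cast_nonneg _).trans hp.le
  refine (((integrable_truncKernel (μ := μ) hp hε).mul_const c).add
    ((hG.comp_add_left y).bdd_mul (c := (ε ^ p)⁻¹)
      (measurable_truncKernel p ε).aestronglyMeasurable
      (.of_forall fun z => by
        rw [Real.norm_of_nonneg (truncKernel_nonneg p ε z)]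
        exact truncKernel_le hp0 hε z))).mono'
    ((measurable_truncKernel p ε).mul (by fun_prop)).aestronglyMeasurable (.of_forall fun z => ?_)
  have := mul_le_mul_of_nonneg_left (hfG (y + z)) (truncKernel_nonneg p ε z)
  rw [norm_mul, Real.norm_of_nonneg (truncKernel_nonneg p ε z), Real.norm_eq_abs]
  simpa [mul_add] using this

lemma integrableOn_ball_sq_mul_norm_rpow_inv {μ : Measure E} [Measure.IsAddHaarMeasure μ] {p : ℝ}
    (hp : p < Module.finrank ℝ E + 2) (r : ℝ) :
    IntegrableOn (fun z : E => ‖z‖ ^ 2 * (‖z‖ ^ p)⁻¹) (ball 0 r) μ := by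
  rcases Nat.eq_zero_or_pos (Module.finrank ℝ E) with h | h
  · have := Module.finrank_zero_iff.mp h
    exact (continuous_of_discreteTopology.continuousOn.integrableOn_compact
      (isCompact_closedBall 0 r)).mono_set ball_subset_closedBall
  · refine integrableOn_ball_of_norm_le_rpow (C := 1) (α := p - 2) h (by linarith)
      (.of_forall fun z => ?_) (Measurable.aestronglyMeasurable (by fun_prop))
    rw [Real.norm_of_nonneg (by positivity), one_mul, neg_sub]
    rcases eq_or_ne z 0 with rfl | hz
    · simpa using Real.rpow_nonneg le_rfl _
    · rw [Real.rpow_sub (norm_pos_iff.mpr hz), Real.rpow_two, div_eq_mul_inv]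

lemma tendsto_setIntegral_ball_sq_mul_norm_rpow_inv {μ : Measure E} [Measure.IsAddHaarMeasure μ]
    {p : ℝ} (hp : p < Module.finrank ℝ E + 2) :
    Tendsto (fun ε => ∫ z in ball (0 : E) ε, ‖z‖ ^ 2 * (‖z‖ ^ p)⁻¹ ∂μ) (𝓝[>] 0) (𝓝 0) := by
  simp_rw [← integral_indicator (measurableSet_ball (α := E))]
  suffices h : Tendsto (fun ε => ∫ z : E, (ball (0 : E) ε).indicator
      (fun z => ‖z‖ ^ 2 * (‖z‖ ^ p)⁻¹) z ∂μ) (𝓝[>] 0) (𝓝 (∫ _ : E, (0 : ℝ) ∂μ)) by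
    simpa using h
  refine tendsto_integral_filter_of_dominated_convergence
    ((ball (0 : E) 1).indicator fun z => ‖z‖ ^ 2 * (‖z‖ ^ p)⁻¹)
    (.of_forall fun ε => Measurable.aestronglyMeasurable
      (Measurable.indicator (by fun_prop) measurableSet_ball)) ?_
    ((integrableOn_ball_sq_mul_norm_rpow_inv hp 1).integrable_indicator measurableSet_ball) ?_
  · filter_upwards [Ioo_mem_nhdsGT one_pos] with ε hε
    refine .of_forall fun z => ?_
    rw [Real.norm_of_nonneg (Set.indicator_nonneg (fun _ _ => by positivity) z)]
    exact Set.indicator_le_indicator_of_subset (ball_subset_ball hε.2.le)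
      (fun _ => by positivity) z
  · refine .of_forall fun z => tendsto_const_nhds.congr' ?_
    rcases eq_or_ne z 0 with rfl | hz
    · exact .of_forall fun ε => by simp [Set.indicator]
    · filter_upwards [Ioo_mem_nhdsGT (norm_pos_iff.mpr hz)] with ε hε
      rw [Set.indicator_of_notMem (by simpa using hε.2.le)]

/-- Quantitative convergence of the principal value integral defining the fractional Laplacian. -/
lemma abs_integral_truncKernel_sub_limUnder_le {μ : Measure E} [Measure.IsAddHaarMeasure μ]
    {p : ℝ} (hp : p < Module.finrank ℝ E + 2) {f : E → ℝ} (hf : Differentiable ℝ f)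
    {K : NNReal} {R : ℝ} (hK : LipschitzOnWith K (fderiv ℝ f) (ball 0 (R + 1))) {y : E}
    (hy : ‖y‖ ≤ R)
    (hint : ∀ ε : ℝ, 0 < ε → Integrable (fun z => truncKernel p ε z * (f y - f (y + z))) μ)
    {ε : ℝ} (hε : 0 < ε) (hε1 : ε ≤ 1) :
    |∫ z, truncKernel p ε z * (f y - f (y + z)) ∂μ -
      limUnder (𝓝[>] (0 : ℝ)) (fun ε => ∫ z, truncKernel p ε z * (f y - f (y + z)) ∂μ)| ≤
      K * ∫ z in ball (0 : E) ε, ‖z‖ ^ 2 * (‖z‖ ^ p)⁻¹ ∂μ := by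
  set h : E → ℝ := fun z => (‖z‖ ^ p)⁻¹ *
    (f y - f (y + z) + (ball (0 : E) 1).indicator (fderiv ℝ f y) z) with hh
  have hfc := hf.continuous
  have hmeas : Measurable h := by
    refine Measurable.mul (by fun_prop) (Measurable.add (by fun_prop) ?_)
    exact Measurable.indicator (by fun_prop) measurableSet_ball
  have hbound : ∀ z ∈ ball (0 : E) 1, ‖h z‖ ≤ K * (‖z‖ ^ 2 * (‖z‖ ^ p)⁻¹) := by
    intro z hz
    have hz1 : ‖z‖ < 1 := by simpa using hz
    have hs : closedBall y ‖z‖ ⊆ ball (0 : E) (R + 1) :=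
      closedBall_subset_ball' (by rw [dist_zero_right]; linarith)
    rw [hh, norm_mul, Set.indicator_of_mem hz, Real.norm_of_nonneg (by positivity),
      Real.norm_eq_abs, ← mul_assoc, mul_comm]
    gcongr
    exact abs_sub_add_fderiv_le hf hK hs
  have hI : Integrable h μ := by
    rw [← integrableOn_univ, ← Set.union_compl_self (ball (0 : E) 1), integrableOn_union]
    constructor
    · exact ((integrableOn_ball_sq_mul_norm_rpow_inv hp 1).const_mul (K : ℝ)).mono'
        hmeas.aestronglyMeasurable (ae_restrict_of_forall_mem measurableSet_ball hbound)
    · refine (hint 1 one_pos).integrableOn.congr_fun (fun z hz => ?_) measurableSet_ball.compl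
      have hz1 : 1 ≤ ‖z‖ := by simpa using hz
      simp [hh, truncKernel, hz1]
  have key : ∀ ε : ℝ, 0 < ε → ε ≤ 1 → ∫ z, truncKernel p ε z * (f y - f (y + z)) ∂μ =
      ∫ z, h z ∂μ - ∫ z in ball (0 : E) ε, h z ∂μ := by
    intro ε hε hε1
    set q : E → ℝ := fun z => truncKernel p ε z * (ball (0 : E) 1).indicator (fderiv ℝ f y) z
      with hq
    have hdecomp : ∀ z, q z = (ball (0 : E) ε)ᶜ.indicator h z -
        truncKernel p ε z * (f y - f (y + z)) := by
      intro z
      by_cases hz : ε ≤ ‖z‖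
      · simp only [hq, hh, truncKernel, Set.indicator, Set.mem_ofPred_eq, hz, if_true,
          Set.mem_compl_iff, mem_ball, dist_zero_right, not_lt]
        ring
      · simp [hq, truncKernel, Set.indicator, hz]
    have hodd : ∫ z, q z ∂μ = 0 := by
      have h1 := integral_neg_eq_self q μ
      have h2 : ∀ z, q (-z) = -q z := fun z => by
        simp only [hq, truncKernel_neg, Set.indicator, mem_ball, dist_zero_right, norm_neg, map_neg]
        split_ifs <;> simp
      simp_rw [h2, integral_neg] at h1
      linarith
    have hIc : Integrable ((ball (0 : E) ε)ᶜ.indicator h) μ :=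
      hI.indicator measurableSet_ball.compl
    simp_rw [hdecomp] at hodd
    rw [integral_sub hIc (hint ε hε), integral_indicator measurableSet_ball.compl] at hodd
    have := integral_add_compl (measurableSet_ball (x := (0 : E)) (ε := ε)) hI
    linarith
  have hrate : ∀ ε : ℝ, ε ≤ 1 → |∫ z in ball (0 : E) ε, h z ∂μ| ≤
      K * ∫ z in ball (0 : E) ε, ‖z‖ ^ 2 * (‖z‖ ^ p)⁻¹ ∂μ := by
    intro ε hε1
    rw [← integral_const_mul]
    exact norm_integral_le_of_norm_le
      ((integrableOn_ball_sq_mul_norm_rpow_inv hp ε).const_mul (K : ℝ))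
      (ae_restrict_of_forall_mem measurableSet_ball
        fun z hz => hbound z (ball_subset_ball hε1 hz))
  have hlim0 : Tendsto (fun ε => ∫ z in ball (0 : E) ε, h z ∂μ) (𝓝[>] 0) (𝓝 0) := by
    refine squeeze_zero_norm' ?_ (by
      simpa using (tendsto_setIntegral_ball_sq_mul_norm_rpow_inv (μ := μ) hp).const_mul (K : ℝ))
    filter_upwards [Ioo_mem_nhdsGT (zero_lt_one' ℝ)] with ε hε using hrate ε hε.2.le
  have hlim : Tendsto (fun ε => ∫ z, truncKernel p ε z * (f y - f (y + z)) ∂μ) (𝓝[>] 0)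
      (𝓝 (∫ z, h z ∂μ)) := by
    have h1 := hlim0.const_sub (∫ z, h z ∂μ)
    rw [sub_zero] at h1
    refine h1.congr' ?_
    filter_upwards [Ioo_mem_nhdsGT (zero_lt_one' ℝ)] with ε hε using (key ε hε.1 hε.2.le).symm
  rw [hlim.limUnder_eq, key ε hε hε1, sub_sub_cancel_left, abs_neg]
  exact hrate ε hε1

/-- The averages over unit balls of a nonzero continuous square integrable function `g ≥ 0` attain
a positive maximum. -/
lemma exists_isMaxOn_setIntegral_comp_add {μ : Measure E} [Measure.IsAddHaarMeasure μ] {g : E → ℝ}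
    (hg : Continuous g) (hg0 : ∀ x, 0 ≤ g x) (hg2 : Integrable (fun x => g x ^ 2) μ)
    {x₀ : E} (hx₀ : 0 < g x₀) :
    ∃ x₁, 0 < ∫ b in closedBall (0 : E) 1, g (x₁ + b) ∂μ ∧
      ∀ x, ∫ b in closedBall (0 : E) 1, g (x + b) ∂μ ≤
        ∫ b in closedBall (0 : E) 1, g (x₁ + b) ∂μ := by
  set W : E → ℝ := fun x => ∫ b in closedBall (0 : E) 1, g (x + b) ∂μ with hW
  have hWc : Continuous W :=
    continuous_parametric_integral_of_continuous (f := fun x b => g (x + b)) (by fun_prop)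
      (isCompact_closedBall 0 1)
  have hgI : ∀ x, IntegrableOn (fun b => g (x + b)) (closedBall (0 : E) 1) μ := fun x =>
    (Continuous.continuousOn (by fun_prop)).integrableOn_compact (isCompact_closedBall 0 1)
  have hW0 : 0 < W x₀ := by
    refine (setIntegral_pos_iff_support_of_nonneg_ae (.of_forall fun b => hg0 _) (hgI x₀)).mpr ?_
    refine lt_of_lt_of_le ?_ (measure_mono (Set.inter_subset_inter_right _ ball_subset_closedBall))
    refine IsOpen.measure_pos μ (IsOpen.inter ?_ isOpen_ball) ⟨0, ?_⟩
    · exact Continuous.isOpen_support (by fun_prop)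
    · simp [hx₀.ne']
  obtain ⟨x₁, hx₁⟩ : ∃ x₁, ∀ x, W x ≤ W x₁ := by
    refine hWc.exists_forall_ge_of_isBounded x₀ ?_
    set V : ℝ := μ.real (closedBall (0 : E) 1) with hV
    have hV0 : 0 ≤ V := measureReal_nonneg
    set δ : ℝ := W x₀ / (2 * (V + 1)) with hδ
    have hδ0 : 0 < δ := by positivity
    have hδV : δ * V < W x₀ / 2 := by
      rw [hδ, div_mul_eq_mul_div, div_lt_iff₀ (by positivity)]
      nlinarith
    obtain ⟨r, hr⟩ := ((tendsto_setIntegral_compl_ball_zero hg2).eventually_lt_const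
      (show (0 : ℝ) < δ * (W x₀ / 2) by positivity)).exists
    refine isBounded_ball (x := (0 : E)) (r := r + 1) |>.subset fun x (hx : W x₀ ≤ W x) => ?_
    by_contra hxr
    have hxr : r + 1 ≤ ‖x‖ := by simpa using hxr
    have hg2I : IntegrableOn (fun b => g (x + b) ^ 2) (closedBall (0 : E) 1) μ :=
      (hg2.comp_add_left x).integrableOn
    have h1 : W x ≤ δ * V + δ⁻¹ * ∫ b in closedBall (0 : E) 1, g (x + b) ^ 2 ∂μ := by
      have : δ * V = ∫ b in closedBall (0 : E) 1, δ ∂μ := by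
        rw [setIntegral_const, smul_eq_mul, mul_comm]
      have hδI : IntegrableOn (fun _ : E => δ) (closedBall (0 : E) 1) μ :=
        continuousOn_const.integrableOn_compact (isCompact_closedBall 0 1)
      rw [this, ← integral_const_mul, ← integral_add hδI (hg2I.const_mul _)]
      refine integral_mono (hgI x) (hδI.add (hg2I.const_mul _)) fun b => ?_
      have : g (x + b) ≤ δ + δ⁻¹ * g (x + b) ^ 2 := by
        rw [← mul_le_mul_iff_right₀ hδ0, mul_add, mul_inv_cancel_left₀ hδ0.ne']
        nlinarith [sq_nonneg (g (x + b) - δ), sq_nonneg (g (x + b)), sq_nonneg δ]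
      exact this
    have h2 : ∫ b in closedBall (0 : E) 1, g (x + b) ^ 2 ∂μ ≤
        ∫ y in (ball (0 : E) r)ᶜ, g y ^ 2 ∂μ := by
      rw [← integral_indicator measurableSet_closedBall,
        ← integral_indicator measurableSet_ball.compl,
        ← integral_add_left_eq_self ((ball (0 : E) r)ᶜ.indicator _) x]
      have htail : Integrable (fun b => (ball (0 : E) r)ᶜ.indicator (fun y => g y ^ 2) (x + b)) μ :=
        (hg2.indicator measurableSet_ball.compl).comp_add_left x
      refine integral_mono ((hg2.comp_add_left x).indicator measurableSet_closedBall) htail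
        fun b => ?_
      refine Set.indicator_apply_le' (fun hb => ?_)
        (fun _ => Set.indicator_nonneg (fun _ _ => by positivity) _)
      have hb1 : ‖b‖ ≤ 1 := by simpa using hb
      have hxb : r ≤ ‖x + b‖ := by
        have := norm_sub_le (x + b) b
        rw [add_sub_cancel_right] at this
        linarith
      rw [Set.indicator_of_mem (by simpa using hxb)]
    have h3 : δ⁻¹ * ∫ b in closedBall (0 : E) 1, g (x + b) ^ 2 ∂μ < W x₀ / 2 := by
      rw [inv_mul_lt_iff₀ hδ0]
      exact h2.trans_lt hr
    linarith
  exact ⟨x₁, hW0.trans_le (hx₁ x₀), hx₁⟩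

lemma setIntegral_integral_mul_comp_add_le {μ : Measure E} [Measure.IsAddHaarMeasure μ]
    {k g : E → ℝ} (hk : Measurable k) (hk0 : ∀ z, 0 ≤ k z) (hkI : Integrable k μ)
    (hg : Continuous g) (hg0 : ∀ x, 0 ≤ g x) {s : Set E} (hs : IsCompact s) {x₁ : E}
    (hmax : ∀ x, ∫ b in s, g (x + b) ∂μ ≤ ∫ b in s, g (x₁ + b) ∂μ) :
    IntegrableOn (fun b => ∫ z, k z * g (x₁ + b + z) ∂μ) s μ ∧
      ∫ b in s, ∫ z, k z * g (x₁ + b + z) ∂μ ∂μ ≤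
        (∫ z, k z ∂μ) * ∫ b in s, g (x₁ + b) ∂μ := by
  have hWc : Continuous fun z => ∫ b in s, g (x₁ + b + z) ∂μ :=
    continuous_parametric_integral_of_continuous (f := fun z b => g (x₁ + b + z)) (by fun_prop) hs
  have hW0 : ∀ z, 0 ≤ ∫ b in s, g (x₁ + b + z) ∂μ := fun z => integral_nonneg fun b => hg0 _
  have hWle : ∀ z, ∫ b in s, g (x₁ + b + z) ∂μ ≤ ∫ b in s, g (x₁ + b) ∂μ := fun z => by
    simpa only [add_right_comm] using hmax (x₁ + z)
  have hkW : Integrable (fun z => k z * ∫ b in s, g (x₁ + b + z) ∂μ) μ :=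
    hkI.mul_bdd (c := ∫ b in s, g (x₁ + b) ∂μ) hWc.aestronglyMeasurable (.of_forall fun z => by
      rw [Real.norm_of_nonneg (hW0 z)]
      exact hWle z)
  have hprod : Integrable (Function.uncurry fun b z => k z * g (x₁ + b + z))
      ((μ.restrict s).prod μ) := by
    refine (integrable_prod_iff' (Measurable.aestronglyMeasurable ?_)).mpr
      ⟨.of_forall fun z => ?_, ?_⟩
    · exact (hk.comp measurable_snd).mul (by fun_prop)
    · have hgI : IntegrableOn (fun b => g (x₁ + b + z)) s μ :=
        (Continuous.continuousOn (by fun_prop)).integrableOn_compact hs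
      exact hgI.const_mul (k z)
    · refine hkW.congr (.of_forall fun z => ?_)
      simp only [Function.uncurry_apply_pair, norm_mul, Real.norm_of_nonneg (hk0 _),
        Real.norm_of_nonneg (hg0 _), integral_const_mul]
  refine ⟨hprod.integral_prod_left, ?_⟩
  rw [integral_integral_swap hprod, ← integral_mul_const]
  simp_rw [integral_const_mul]
  exact integral_mono hkW (hkI.mul_const _) fun z => mul_le_mul_of_nonneg_left (hWle z) (hk0 z)

/-- A maximum principle: a square integrable nonnegative function that approximately satisfies
`(-Δ)^{α/2} g ≤ -c g` at the level of truncated integrals vanishes. -/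
lemma eq_zero_of_truncated_subsolution {μ : Measure E} [Measure.IsAddHaarMeasure μ]
    {p c : ℝ} (hp : Module.finrank ℝ E < p) (hc : 0 < c) {g : E → ℝ} (hg : Continuous g)
    (hg0 : ∀ x, 0 ≤ g x) (hg2 : Integrable (fun x => g x ^ 2) μ) {m : ℝ → ℝ}
    (hm : Tendsto m (𝓝[>] 0) (𝓝 0))
    (hsub : ∀ R : ℝ, ∃ M : ℝ, ∀ ε : ℝ, 0 < ε → ε ≤ 1 → ∀ y : E, ‖y‖ ≤ R →
      ((∫ z : E, truncKernel p ε z ∂μ) + c) * g y ≤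
        (∫ z, truncKernel p ε z * g (y + z) ∂μ) + M * m ε) (x : E) : g x = 0 := by
  by_contra hx
  obtain ⟨x₁, hpos, hmax⟩ :=
    exists_isMaxOn_setIntegral_comp_add hg hg0 hg2 ((hg0 x).lt_of_ne' hx)
  obtain ⟨M, hM⟩ := hsub (‖x₁‖ + 1)
  set W := ∫ b in closedBall (0 : E) 1, g (x₁ + b) ∂μ
  set V : ℝ := μ.real (closedBall (0 : E) 1)
  have hbd : ∀ ε : ℝ, 0 < ε → ε ≤ 1 → c * W ≤ V * (M * m ε) := by
    intro ε hε hε1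
    obtain ⟨hI, hle⟩ := setIntegral_integral_mul_comp_add_le (measurable_truncKernel p ε)
      (truncKernel_nonneg p ε) (integrable_truncKernel (μ := μ) hp hε) hg hg0
      (isCompact_closedBall (0 : E) 1) hmax
    have hconst : IntegrableOn (fun _ : E => M * m ε) (closedBall (0 : E) 1) μ :=
      continuousOn_const.integrableOn_compact (isCompact_closedBall 0 1)
    have hgI : IntegrableOn (fun b => g (x₁ + b)) (closedBall (0 : E) 1) μ :=
      (Continuous.continuousOn (by fun_prop)).integrableOn_compact (isCompact_closedBall 0 1)
    have h := setIntegral_mono_on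
      (hgI.const_mul ((∫ z : E, truncKernel p ε z ∂μ) + c)) (hI.add hconst)
      measurableSet_closedBall fun b hb => hM ε hε hε1 (x₁ + b) ((norm_add_le _ _).trans
        (by gcongr; simpa using hb))
    simp only [Pi.add_apply] at h
    rw [integral_const_mul, integral_add hI hconst, setIntegral_const, smul_eq_mul] at h
    linarith
  have hlim : Tendsto (fun ε => V * (M * m ε)) (𝓝[>] 0) (𝓝 0) := by
    simpa using (hm.const_mul M).const_mul V
  have : c * W ≤ 0 := ge_of_tendsto hlim (by
    filter_upwards [Ioo_mem_nhdsGT (zero_lt_one' ℝ)] with ε hε using hbd ε hε.1 hε.2.le)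
  exact this.not_gt (mul_pos hc hpos)

end TruncatedKernel

lemma fracLap_eq_limUnder_truncKernel (n : ℕ) (α C : ℝ) (f : EuclideanSpace ℝ (Fin n) → ℝ)
    (x : EuclideanSpace ℝ (Fin n)) :
    fracLap n α C f x = C * limUnder (𝓝[>] (0 : ℝ))
      (fun ε => ∫ z, truncKernel ((n : ℝ) + α) ε z * (f x - f (x + z))) := by
  unfold fracLap
  congr 2
  funext ε
  have hm : MeasurableSet {y : EuclideanSpace ℝ (Fin n) | ε ≤ dist x y} :=
    measurableSet_le measurable_const (by fun_prop)
  rw [← integral_indicator hm, ← integral_add_left_eq_self _ x]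
  refine integral_congr_ae (.of_forall fun z => ?_)
  simp [truncKernel, Set.indicator, div_eq_mul_inv, mul_comm]

/-- Vector-valued Brezis theorem for the fractional Ginzburg–Landau system. -/
theorem stmt14 (n N : ℕ) (α C : ℝ) (hα : 0 < α) (hα2 : α < 2) (hC : 0 < C)
    (u : EuclideanSpace ℝ (Fin n) → EuclideanSpace ℝ (Fin N))
    (hu : ∀ i : Fin N, MemE n α (fun x => u x i))
    (heq : ∀ i : Fin N, ∀ x,
      fracLap n α C (fun x => u x i) x = u x i * (1 - ‖u x‖ ^ 2))
    (hint : Integrable (fun x : EuclideanSpace ℝ (Fin n) => (1 - ‖u x‖ ^ 2) ^ 2)) :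
    ∀ x, ‖u x‖ ≤ 1 := by
  set p : ℝ := (n : ℝ) + α with hp
  have hp1 : (Module.finrank ℝ (EuclideanSpace ℝ (Fin n)) : ℝ) < p := by simp [hp, hα]
  have hp2 : p < Module.finrank ℝ (EuclideanSpace ℝ (Fin n)) + 2 := by simp [hp, hα2]
  have hucomp : ∀ i, Continuous fun x => u x i := fun i => (hu i).1.continuous
  have hucont : Continuous u := (differentiable_euclidean.mpr fun i => (hu i).1).continuous
  have hui : ∀ i y, |u y i| ≤ ‖u y‖ := fun i y => PiLp.norm_apply_le (u y) i
  set g : EuclideanSpace ℝ (Fin n) → ℝ := fun x => max (‖u x‖ ^ 2 - 1) 0 with hgdef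
  have hg : Continuous g := by fun_prop
  have hg0 : ∀ x, 0 ≤ g x := fun x => le_max_right _ _
  have hgle : ∀ x, g x ^ 2 ≤ (1 - ‖u x‖ ^ 2) ^ 2 := fun x => by
    rcases le_total (‖u x‖ ^ 2 - 1) 0 with h | h
    · simp only [hgdef, max_eq_right h, ne_eq, two_ne_zero, not_false_eq_true, zero_pow]
      positivity
    · simp only [hgdef, max_eq_left h]
      exact le_of_eq (by ring)
  have hg2 : Integrable (fun x => g x ^ 2) :=
    hint.mono' (by fun_prop) (.of_forall fun x => by
      rw [Real.norm_of_nonneg (by positivity)]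
      exact hgle x)
  have hIg : ∀ ε : ℝ, 0 < ε → ∀ y : EuclideanSpace ℝ (Fin n),
      Integrable fun z => truncKernel p ε z * g (y + z) :=
    fun ε hε y => integrable_truncKernel_mul_comp_add hp1 hε hg hint 1 (fun x => by
      rw [abs_of_nonneg (hg0 x)]
      nlinarith [hgle x, sq_nonneg (g x - 1)]) y
  have hIu : ∀ i, ∀ y : EuclideanSpace ℝ (Fin n), ∀ ε : ℝ, 0 < ε →
      Integrable fun z => truncKernel p ε z * (u y i - u (y + z) i) := by
    intro i y ε hε
    have h1 := (integrable_truncKernel (μ := (volume : Measure (EuclideanSpace ℝ (Fin n)))) hp1 hε).mul_const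
      (u y i)
    have h2 := integrable_truncKernel_mul_comp_add hp1 hε (hucomp i) hint 3 (fun x => by
      nlinarith [hui i x, sq_nonneg (‖u x‖ - 1), sq_nonneg (‖u x‖ ^ 2 - 2), sq_nonneg (‖u x‖)]) y
    simp_rw [mul_sub]
    exact h1.sub h2
  suffices h : ∀ x, g x = 0 by
    intro x
    have h1 : ‖u x‖ ^ 2 - 1 ≤ 0 := (le_max_left _ _).trans_eq (h x)
    nlinarith [norm_nonneg (u x)]
  refine eq_zero_of_truncated_subsolution (c := 2 / C) hp1 (by positivity) hg hg0 hg2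
    (tendsto_setIntegral_ball_sq_mul_norm_rpow_inv (μ := volume) hp2) fun R => ?_
  choose K hK using fun i => (hu i).2.1 (R + 1)
  obtain ⟨A, hA⟩ := (isCompact_closedBall (0 : EuclideanSpace ℝ (Fin n)) R)
    |>.exists_bound_of_continuousOn hucont.continuousOn
  refine ⟨∑ i, 2 * |A| * K i, fun ε hε hε1 y hy => ?_⟩
  set m : ℝ := ∫ z in ball (0 : EuclideanSpace ℝ (Fin n)) ε, ‖z‖ ^ 2 * (‖z‖ ^ p)⁻¹
  have hm0 : 0 ≤ m := integral_nonneg fun z => by positivity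
  have hIg0 : 0 ≤ ∫ z, truncKernel p ε z * g (y + z) :=
    integral_nonneg fun z => mul_nonneg (truncKernel_nonneg p ε z) (hg0 _)
  rcases le_total (‖u y‖ ^ 2 - 1) 0 with hy1 | hy1
  · have : g y = 0 := max_eq_right hy1
    rw [this, mul_zero]
    positivity
  have hgy : g y = ‖u y‖ ^ 2 - 1 := max_eq_left hy1
  have hk := integrable_truncKernel (μ := (volume : Measure (EuclideanSpace ℝ (Fin n)))) hp1 hε
  have hdiff : (∫ z : EuclideanSpace ℝ (Fin n), truncKernel p ε z) * g y -
      ∫ z, truncKernel p ε z * g (y + z) ≤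
      ∑ i, 2 * u y i * ∫ z, truncKernel p ε z * (u y i - u (y + z) i) := by
    rw [← integral_mul_const, ← integral_sub (hk.mul_const _) (hIg ε hε y)]
    simp_rw [← integral_const_mul]
    rw [← integral_finsetSum _ fun i _ => (hIu i y ε hε).const_mul _]
    refine integral_mono ((hk.mul_const _).sub (hIg ε hε y))
      (integrable_finsetSum _ fun i _ => (hIu i y ε hε).const_mul _) fun z => ?_
    have h1 : g y - g (y + z) ≤ ∑ i, 2 * u y i * (u y i - u (y + z) i) := by
      have h2 : ‖u (y + z)‖ ^ 2 - 1 ≤ g (y + z) := le_max_left _ _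
      have h3 : ‖u y‖ ^ 2 - ‖u (y + z)‖ ^ 2 ≤ ∑ i, 2 * u y i * (u y i - u (y + z) i) := by
        rw [EuclideanSpace.real_norm_sq_eq, EuclideanSpace.real_norm_sq_eq,
          ← Finset.sum_sub_distrib]
        exact Finset.sum_le_sum fun i _ => by nlinarith [sq_nonneg (u y i - u (y + z) i)]
      linarith
    have h4 := mul_le_mul_of_nonneg_left h1 (truncKernel_nonneg p ε z)
    rw [mul_sub, Finset.mul_sum] at h4
    refine h4.trans_eq (Finset.sum_congr rfl fun i _ => by ring)
  have hterm : ∀ i, 2 * u y i * ∫ z, truncKernel p ε z * (u y i - u (y + z) i) ≤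
      2 / C * ((1 - ‖u y‖ ^ 2) * u y i ^ 2) + 2 * |A| * K i * m := by
    intro i
    have h1 := abs_integral_truncKernel_sub_limUnder_le (μ := volume) hp2 (hu i).1 (hK i) hy
      (hIu i y) hε hε1
    have h2 := heq i y
    rw [fracLap_eq_limUnder_truncKernel, mul_comm C, ← eq_div_iff hC.ne'] at h2
    rw [h2] at h1
    have h3 : |u y i| ≤ |A| :=
      (hui i y).trans ((hA y (by simpa using hy)).trans (le_abs_self A))
    set L := ∫ z, truncKernel p ε z * (u y i - u (y + z) i)
    have h4 : u y i * (L - u y i * (1 - ‖u y‖ ^ 2) / C) ≤ |A| * (K i * m) :=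
      (le_abs_self _).trans (by rw [abs_mul]; gcongr)
    calc 2 * u y i * L = 2 / C * ((1 - ‖u y‖ ^ 2) * u y i ^ 2) +
          2 * (u y i * (L - u y i * (1 - ‖u y‖ ^ 2) / C)) := by ring
      _ ≤ _ := by linarith
  have hsum := Finset.sum_le_sum fun i (_ : i ∈ Finset.univ) => hterm i
  rw [Finset.sum_add_distrib, ← Finset.mul_sum, ← Finset.mul_sum, ← Finset.sum_mul,
    ← EuclideanSpace.real_norm_sq_eq] at hsum
  have hneg : (1 - ‖u y‖ ^ 2) * ‖u y‖ ^ 2 ≤ -g y := by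
    rw [hgy]
    nlinarith
  have hneg' := mul_le_mul_of_nonneg_left hneg (show 0 ≤ 2 / C by positivity)
  linarith
end
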